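/- arXiv:2401.16174 — 3 statements merged into one kernel-verified Lean document; each statement's English description precedes it below -/
import Mathlib

section
/- Let V be a finite-dimensional complex vector space of dimension n, and let 𝒯 be a family of pairwise commuting, diagonalizable linear endomorphisms of V that is closed under taking finite ℚ-linear combinations (i.e., 𝒯 is a ℚ-submodule of End_ℂ(V) all of whose elements are diagonalizable and commute pairwise). Suppose there exists a number field E ⊆ ℂ such that for every T ∈ 𝒯 all coefficients of the characteristic polynomial of T lie in E. Then there exists a number field E' ⊆ ℂ such that every eigenvalue of every T ∈ 𝒯 lies in E'. -/
open Module

/-- A line through the origin of rational slope separates the points of a finite grid. -/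
theorem exists_rat_add_mul_injOn {A B : Set ℂ} (hA : A.Finite) (hB : B.Finite) :
    ∃ q : ℚ, ∀ a ∈ A, ∀ a' ∈ A, ∀ b ∈ B, ∀ b' ∈ B,
      a + q * b = a' + q * b' → a = a' ∧ b = b' := by
  have hF : ((fun x : (ℂ × ℂ) × (ℂ × ℂ) => (x.1.2 - x.1.1) / (x.2.1 - x.2.2)) ''
      ((A ×ˢ A) ×ˢ (B ×ˢ B))).Finite := ((hA.prod hA).prod (hB.prod hB)).image _
  obtain ⟨_, ⟨q, rfl⟩, hq⟩ :=
    (Set.infinite_range_of_injective (Rat.cast_injective (α := ℂ))).exists_notMem_finite hF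
  refine ⟨q, fun a ha a' ha' b hb b' hb' h => ?_⟩
  by_cases hbb : b = b'
  · subst hbb
    exact ⟨by simpa using h, rfl⟩
  · refine (hq ⟨((a, a'), (b, b')), ⟨⟨ha, ha'⟩, ⟨hb, hb'⟩⟩, ?_⟩).elim
    rw [div_eq_iff (sub_ne_zero.mpr hbb)]
    linear_combination -h

section JointEigenvalues

variable {V : Type*} [AddCommGroup V] [Module ℂ V]

/-- The pairs of scalars by which `S` and `T` act on a common eigenvector. -/
def jointEigenvalues (S T : End ℂ V) : Set (ℂ × ℂ) :=
  {x | ∃ v : V, v ≠ 0 ∧ S v = x.1 • v ∧ T v = x.2 • v}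

theorem hasEigenvalue_of_apply_eq_smul {T : End ℂ V} {a : ℂ} {v : V} (hv : v ≠ 0)
    (h : T v = a • v) : T.HasEigenvalue a :=
  End.hasEigenvalue_of_hasEigenvector ⟨End.mem_eigenspace_iff.mpr h, hv⟩

theorem hasEigenvalue_of_mem_jointEigenvalues {S T : End ℂ V} {x : ℂ × ℂ}
    (hx : x ∈ jointEigenvalues S T) : S.HasEigenvalue x.1 ∧ T.HasEigenvalue x.2 := by
  obtain ⟨v, hv, hS, hT⟩ := hx
  exact ⟨hasEigenvalue_of_apply_eq_smul hv hS, hasEigenvalue_of_apply_eq_smul hv hT⟩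

theorem hasEigenvalue_add_smul_of_mem_jointEigenvalues {S T : End ℂ V} {x : ℂ × ℂ}
    (hx : x ∈ jointEigenvalues S T) (q : ℂ) : (S + q • T).HasEigenvalue (x.1 + q * x.2) := by
  obtain ⟨v, hv, hS, hT⟩ := hx
  refine hasEigenvalue_of_apply_eq_smul hv ?_
  simp [hS, hT, add_smul, mul_smul]

variable [FiniteDimensional ℂ V]

theorem ncard_setOf_hasEigenvalue_le_finrank (T : End ℂ V) :
    {a | T.HasEigenvalue a}.ncard ≤ finrank ℂ V := by
  classical
  have h : {a | T.HasEigenvalue a} = T.charpoly.roots.toFinset := by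
    ext a
    simp [T.charpoly_monic.ne_zero, End.hasEigenvalue_iff_isRoot_charpoly]
  rw [h, Set.ncard_coe_finset, ← LinearMap.charpoly_natDegree T]
  exact (Multiset.toFinset_card_le _).trans (Polynomial.card_roots' _)

theorem finite_jointEigenvalues (S T : End ℂ V) : (jointEigenvalues S T).Finite :=
  ((End.finite_hasEigenvalue S).prod (End.finite_hasEigenvalue T)).subset
    fun _ hx => hasEigenvalue_of_mem_jointEigenvalues hx

theorem exists_mem_jointEigenvalues {S T : End ℂ V} (hST : Commute S T) {a : ℂ}
    (ha : S.HasEigenvalue a) : ∃ b, (a, b) ∈ jointEigenvalues S T := by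
  have hmaps : ∀ v ∈ S.eigenspace a, T v ∈ S.eigenspace a :=
    End.mapsTo_genEigenspace_of_comm hST a 1
  have : Nontrivial (S.eigenspace a) := Submodule.nontrivial_iff_ne_bot.mpr ha
  obtain ⟨b, hb⟩ := End.exists_eigenvalue (T.restrict hmaps)
  obtain ⟨v, hv⟩ := hb.exists_hasEigenvector
  refine ⟨b, v, by simpa using hv.2, End.mem_eigenspace_iff.mp v.2, ?_⟩
  simpa using congrArg Subtype.val hv.apply_eq_smul

theorem exists_mem_jointEigenvalues_of_add_smul {S T : End ℂ V} (hST : Commute S T) {q c : ℂ}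
    (hc : (S + q • T).HasEigenvalue c) : ∃ x ∈ jointEigenvalues S T, c = x.1 + q * x.2 := by
  have hcomm : Commute (S + q • T) T := hST.add_left ((Commute.refl T).smul_left q)
  obtain ⟨b, v, hv, h₁, h₂⟩ := exists_mem_jointEigenvalues hcomm hc
  refine ⟨(c - q * b, b), ⟨v, hv, ?_, h₂⟩, by simp⟩
  have h₁' : S v + q • b • v = c • v := by simpa [show T v = b • v from h₂] using h₁
  rw [sub_smul, mul_smul, ← h₁', add_sub_cancel_right]

/-- If no `S + q • T` with `q` rational has more eigenvalues than `S`, then `T` has only one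
eigenvalue on each eigenspace of `S`. -/
theorem injOn_fst_jointEigenvalues {S T : End ℂ V} (hST : Commute S T)
    (hmax : ∀ q : ℚ, {a | (S + (q : ℂ) • T).HasEigenvalue a}.ncard ≤
      {a | S.HasEigenvalue a}.ncard) :
    Set.InjOn Prod.fst (jointEigenvalues S T) := by
  obtain ⟨q, hq⟩ := exists_rat_add_mul_injOn (End.finite_hasEigenvalue S)
    (End.finite_hasEigenvalue T)
  have himage : Prod.fst '' jointEigenvalues S T = {a | S.HasEigenvalue a} := by
    ext a
    constructor
    · rintro ⟨x, hx, rfl⟩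
      exact (hasEigenvalue_of_mem_jointEigenvalues hx).1
    · intro ha
      obtain ⟨b, hb⟩ := exists_mem_jointEigenvalues hST ha
      exact ⟨_, hb, rfl⟩
  have hcard : (jointEigenvalues S T).ncard ≤
      {a | (S + (q : ℂ) • T).HasEigenvalue a}.ncard := by
    refine Set.ncard_le_ncard_of_injOn (fun x => x.1 + q * x.2)
      (fun x hx => hasEigenvalue_add_smul_of_mem_jointEigenvalues hx q) ?_
      (End.finite_hasEigenvalue _)
    intro x hx y hy hxy
    have hx' := hasEigenvalue_of_mem_jointEigenvalues hx
    have hy' := hasEigenvalue_of_mem_jointEigenvalues hy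
    exact Prod.ext_iff.mpr (hq _ hx'.1 _ hy'.1 _ hx'.2 _ hy'.2 hxy)
  refine Set.injOn_of_ncard_image_eq ?_ (finite_jointEigenvalues S T)
  refine le_antisymm (Set.ncard_image_le (finite_jointEigenvalues S T)) ?_
  rw [himage]
  exact hcard.trans (hmax q)

end JointEigenvalues

theorem mem_range_algebraMap_of_forall_root_minpoly_eq {K : Type*} [Field K] [CharZero K]
    [Algebra K ℂ] {x : ℂ} (hx : IsIntegral K x)
    (h : ∀ y : ℂ, Polynomial.aeval y (minpoly K x) = 0 → y = x) :
    x ∈ (algebraMap K ℂ).range := by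
  have hsep : (minpoly K x).Separable := (minpoly.irreducible hx).separable
  have hcard := Polynomial.card_rootSet_eq_natDegree hsep
    (IsAlgClosed.splits ((minpoly K x).map (algebraMap K ℂ)))
  have hsub : (minpoly K x).rootSet ℂ ⊆ {x} := fun y hy => h y (Polynomial.mem_rootSet.mp hy).2
  have : Subsingleton ((minpoly K x).rootSet ℂ) :=
    (Set.subsingleton_singleton.anti hsub).coe_sort
  rw [← minpoly.natDegree_eq_one_iff]
  refine le_antisymm ?_ (minpoly.natDegree_pos hx)
  rw [← hcard]
  exact Fintype.card_le_one_iff_subsingleton.mpr this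

/-- **Proposition 3.2 (Wiese's observation).**
Let `V` be a finite-dimensional complex vector space of dimension `n`, and let `𝒯` be a
family of pairwise commuting, diagonalizable endomorphisms of `V`, closed under finite
`ℚ`-linear combinations.  If there is a number field `E ⊆ ℂ` containing all coefficients
of the characteristic polynomial of every `T ∈ 𝒯`, then there is a number field `E' ⊆ ℂ`
containing every eigenvalue of every `T ∈ 𝒯`. -/
theorem stmt0 (V : Type*) [AddCommGroup V] [Module ℂ V] [FiniteDimensional ℂ V]
    (n : ℕ) (hdim : Module.finrank ℂ V = n)
    (𝒯 : Set (Module.End ℂ V))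
    (hzero : (0 : Module.End ℂ V) ∈ 𝒯)
    (hclosed : ∀ (q r : ℚ), ∀ S ∈ 𝒯, ∀ T ∈ 𝒯, (q : ℂ) • S + (r : ℂ) • T ∈ 𝒯)
    (hcomm : ∀ S ∈ 𝒯, ∀ T ∈ 𝒯, S * T = T * S)
    (hdiag : ∀ T ∈ 𝒯, (⨆ μ : ℂ, Module.End.eigenspace T μ) = ⊤)
    (E : Subfield ℂ) (hE : FiniteDimensional ℚ E)
    (hcoeff : ∀ T ∈ 𝒯, ∀ i : ℕ, (LinearMap.charpoly T).coeff i ∈ E) :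
    ∃ E' : Subfield ℂ, FiniteDimensional ℚ E' ∧
      ∀ T ∈ 𝒯, ∀ μ : ℂ, Module.End.HasEigenvalue T μ → μ ∈ E' := by
  have hclosed' : ∀ S ∈ 𝒯, ∀ T ∈ 𝒯, ∀ q : ℚ, S + (q : ℂ) • T ∈ 𝒯 := fun S hS T hT q => by
    simpa using hclosed 1 q S hS T hT
  have hlift : ∀ T ∈ 𝒯, ∃ p : Polynomial E, p.Monic ∧ p.map (algebraMap E ℂ) = T.charpoly := by
    intro T hT
    have hmem : T.charpoly ∈ Polynomial.lifts (algebraMap E ℂ) :=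
      (Polynomial.lifts_iff_coeff_lifts _).mpr fun i => ⟨⟨_, hcoeff T hT i⟩, rfl⟩
    obtain ⟨p, hp, -, hmonic⟩ :=
      Polynomial.lifts_and_degree_eq_and_monic hmem T.charpoly_monic
    exact ⟨p, hmonic, hp⟩
  have hroot : ∀ (T : End ℂ V) (a : ℂ), T.charpoly.eval a = 0 ↔ T.HasEigenvalue a :=
    fun T a => (End.hasEigenvalue_iff_isRoot_charpoly T a).symm
  have hint : ∀ T ∈ 𝒯, ∀ a, T.HasEigenvalue a → IsIntegral E a := by
    intro T hT a ha
    obtain ⟨p, hmonic, hp⟩ := hlift T hT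
    exact ⟨p, hmonic, by rw [← Polynomial.eval_map, hp, hroot]; exact ha⟩
  obtain ⟨S, hS, hmax⟩ : ∃ S ∈ 𝒯, ∀ T ∈ 𝒯,
      {a | T.HasEigenvalue a}.ncard ≤ {a | S.HasEigenvalue a}.ncard := by
    let N : Set ℕ := (fun T : End ℂ V => {a | T.HasEigenvalue a}.ncard) '' 𝒯
    have hN : BddAbove N := by
      refine ⟨finrank ℂ V, ?_⟩
      rintro _ ⟨T, -, rfl⟩
      exact ncard_setOf_hasEigenvalue_le_finrank T
    obtain ⟨S, hS, hSN⟩ := Nat.sSup_mem (Set.Nonempty.image _ ⟨0, hzero⟩ : N.Nonempty) hN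
    exact ⟨S, hS, fun T hT => (le_csSup hN ⟨T, hT, rfl⟩).trans_eq hSN.symm⟩
  let K := IntermediateField.adjoin E {a | S.HasEigenvalue a}
  have hK : FiniteDimensional E K := by
    have : Finite {a | S.HasEigenvalue a} := End.finite_hasEigenvalue S
    exact IntermediateField.finiteDimensional_adjoin fun a ha => hint S hS a ha
  refine ⟨K.toSubfield, FiniteDimensional.trans ℚ E K, fun T hT μ hμ => ?_⟩
  have hST : Commute S T := hcomm S hS T hT
  obtain ⟨l, hl⟩ := exists_mem_jointEigenvalues hST.symm hμ
  replace hl : (l, μ) ∈ jointEigenvalues S T := by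
    obtain ⟨v, hv, h₁, h₂⟩ := hl
    exact ⟨v, hv, h₂, h₁⟩
  have hlS := (hasEigenvalue_of_mem_jointEigenvalues hl).1
  obtain ⟨q, hq⟩ := exists_rat_add_mul_injOn (End.finite_hasEigenvalue S)
    (End.finite_hasEigenvalue T)
  obtain ⟨p, -, hp⟩ := hlift T hT
  obtain ⟨r, -, hr⟩ := hlift _ (hclosed' S hS T hT q)
  have hlK : l ∈ K := IntermediateField.subset_adjoin E _ hlS
  have hp' (y : ℂ) : Polynomial.aeval y (p.map (algebraMap E K)) = T.charpoly.eval y := by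
    rw [Polynomial.aeval_map_algebraMap, ← hp, Polynomial.eval_map_algebraMap]
  have hr' (y : ℂ) : Polynomial.aeval y ((r.map (algebraMap E K)).comp
      (Polynomial.C ⟨l, hlK⟩ + Polynomial.C (q : K) * Polynomial.X)) =
      (S + (q : ℂ) • T).charpoly.eval (l + q * y) := by
    rw [Polynomial.aeval_comp, Polynomial.aeval_map_algebraMap, ← hr,
      Polynomial.eval_map_algebraMap]
    congr 1
    simp
  suffices h : μ ∈ (algebraMap K ℂ).range by
    obtain ⟨x, rfl⟩ := h
    exact x.2
  refine mem_range_algebraMap_of_forall_root_minpoly_eq ((hint T hT μ hμ).tower_top) ?_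
  intro y hy
  have hyT : T.HasEigenvalue y := by
    rw [← hroot, ← hp']
    refine Polynomial.aeval_eq_zero_of_dvd_aeval_eq_zero (minpoly.dvd K μ ?_) hy
    rw [hp', hroot]
    exact hμ
  have hyST : (S + (q : ℂ) • T).HasEigenvalue (l + q * y) := by
    rw [← hroot, ← hr']
    refine Polynomial.aeval_eq_zero_of_dvd_aeval_eq_zero (minpoly.dvd K μ ?_) hy
    rw [hr', hroot]
    exact hasEigenvalue_add_smul_of_mem_jointEigenvalues hl q
  obtain ⟨x, hx, hxy⟩ := exists_mem_jointEigenvalues_of_add_smul hST hyST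
  have hx' := hasEigenvalue_of_mem_jointEigenvalues hx
  obtain ⟨h₁, h₂⟩ := hq l hlS x.1 hx'.1 y hyT x.2 hx'.2 hxy
  have hxl := injOn_fst_jointEigenvalues hST (fun q => hmax _ (hclosed' S hS T hT q)) hx hl h₁.symm
  rw [h₂, hxl]
end

section
/- Let E be a subfield of ℂ, let V be a complex vector space of finite dimension n, and let T : V → V be a linear endomorphism. If Tr(T^m) ∈ E for every integer m with 1 ≤ m ≤ n, then every coefficient of the characteristic polynomial of T lies in E. -/
open Polynomial

namespace Matrix

variable {ι K : Type*} [Fintype ι] [DecidableEq ι] [Field K] [IsAlgClosed K]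

theorem card_roots_charpoly (A : Matrix ι ι K) :
    Multiset.card A.charpoly.roots = Fintype.card ι := by
  rw [← (IsAlgClosed.splits A.charpoly).natDegree_eq_card_roots, charpoly_natDegree_eq_dim]

theorem det_sub_scalar_eq_prod_roots_charpoly (A : Matrix ι ι K) (a : K) :
    (A - scalar ι a).det = (A.charpoly.roots.map fun z => z - a).prod := by
  rw [← neg_sub, det_neg, ← eval_charpoly,
    (IsAlgClosed.splits A.charpoly).eval_eq_prod_roots_of_monic A.charpoly_monic,
    ← card_roots_charpoly A, ← Multiset.card_map (fun z => a - z), ← Multiset.prod_map_neg,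
    Multiset.map_map]
  simp

theorem det_aeval_eq_prod_roots_charpoly (A : Matrix ι ι K) (p : K[X]) :
    (aeval A p).det = (A.charpoly.roots.map fun z => p.eval z).prod := by
  have key (a : K) (s : Multiset K) :
      (aeval A (C a * (s.map fun z => X - C z).prod)).det =
        (A.charpoly.roots.map fun z => (C a * (s.map fun z => X - C z).prod).eval z).prod := by
    induction s using Multiset.induction_on with
    | empty => simp [algebraMap_eq_diagonal, card_roots_charpoly]
    | cons b s ih =>
      rw [Multiset.map_cons, Multiset.prod_cons, mul_left_comm, map_mul, det_mul, ih]
      simp only [eval_mul (p := X - C b), Multiset.prod_map_mul]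
      congr 1
      simpa [algebraMap_eq_diagonal, Pi.algebraMap_def] using det_sub_scalar_eq_prod_roots_charpoly A b
  rw [(IsAlgClosed.splits p).eq_prod_roots]
  exact key _ _

theorem charpoly_pow_eq_prod_roots_charpoly (A : Matrix ι ι K) (m : ℕ) :
    (A ^ m).charpoly = ((A.charpoly.roots.map (· ^ m)).map fun z => X - C z).prod := by
  refine funext fun x => ?_
  have h := det_aeval_eq_prod_roots_charpoly A (C x - X ^ m)
  rw [eval_charpoly, eval_multiset_prod]
  simpa [algebraMap_eq_diagonal, Pi.algebraMap_def, Function.comp_def] using h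

theorem trace_pow_eq_sum_roots_charpoly (A : Matrix ι ι K) (m : ℕ) :
    (A ^ m).trace = (A.charpoly.roots.map (· ^ m)).sum := by
  rw [trace_eq_sum_roots_charpoly, charpoly_pow_eq_prod_roots_charpoly,
    roots_multiset_prod_X_sub_C]

end Matrix

/-- Over a field of characteristic zero, the elementary symmetric functions up to degree `n` lie in
any subfield containing the power sums of degrees `1, …, n`. -/
theorem Multiset.esymm_mem_of_sum_pow_mem {K : Type*} [Field K] [CharZero K] (E : Subfield K)
    (s : Multiset K) (n : ℕ) (hs : ∀ m, 1 ≤ m → m ≤ n → (s.map (· ^ m)).sum ∈ E) :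
    ∀ k ≤ n, s.esymm k ∈ E := by
  obtain ⟨l, rfl⟩ := Quotient.exists_rep s
  have hl : (Finset.univ.val.map l.get : Multiset K) = (l : Multiset K) := by
    simp [Fin.univ_val_map]
  change ∀ m, 1 ≤ m → m ≤ n → ((l : Multiset K).map (· ^ m)).sum ∈ E at hs
  change ∀ k ≤ n, (l : Multiset K).esymm k ∈ E
  rw [← hl] at hs ⊢
  intro k
  induction k using Nat.strong_induction_on with
  | _ k ih =>
    intro hk
    rcases Nat.eq_zero_or_pos k with rfl | hpos
    · simp [Multiset.esymm, E.one_mem]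
    have newton := congrArg (MvPolynomial.aeval l.get)
      (MvPolynomial.mul_esymm_eq_sum (Fin l.length) K k)
    simp only [map_mul, map_natCast, map_pow, map_neg, map_one, map_sum,
      MvPolynomial.aeval_esymm_eq_multiset_esymm] at newton
    rw [← mul_div_cancel_left₀ (Multiset.esymm _ k) (Nat.cast_ne_zero (R := K).mpr hpos.ne'),
      newton]
    have neg_one_pow_mem (j : ℕ) : (-1 : K) ^ j ∈ E := pow_mem (neg_mem E.one_mem) j
    refine E.div_mem (E.mul_mem (neg_one_pow_mem _) (sum_mem fun a ha => ?_)) (natCast_mem E k)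
    obtain ⟨hsum, hlt⟩ := Finset.mem_filter.mp ha
    rw [Finset.HasAntidiagonal.mem_antidiagonal] at hsum
    refine E.mul_mem (E.mul_mem (neg_one_pow_mem _) (ih _ hlt (by lia))) ?_
    have hp := hs a.2 (by lia) (by lia)
    rw [Multiset.map_map] at hp
    simp only [MvPolynomial.psum, map_sum, map_pow, MvPolynomial.aeval_X]
    exact hp

/-- **Strengthened trace step used in Corollary 3.3.**
If `E ⊆ ℂ` is a subfield, `V` an `n`-dimensional complex vector space and `T : V → V`
linear with `Tr(T^m) ∈ E` for all `1 ≤ m ≤ n`, then every coefficient of the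
characteristic polynomial of `T` lies in `E`. -/
theorem stmt2 (E : Subfield ℂ)
    (V : Type*) [AddCommGroup V] [Module ℂ V] [FiniteDimensional ℂ V]
    (n : ℕ) (hdim : Module.finrank ℂ V = n)
    (T : V →ₗ[ℂ] V)
    (htr : ∀ m : ℕ, 1 ≤ m → m ≤ n → LinearMap.trace ℂ V (T ^ m) ∈ E) :
    ∀ i : ℕ, (LinearMap.charpoly T).coeff i ∈ E := by
  intro i
  have hdeg : T.charpoly.natDegree = n := T.charpoly_natDegree.trans hdim
  rcases lt_or_ge n i with hi | hi
  · rw [coeff_eq_zero_of_natDegree_lt (hdeg.trans_lt hi)]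
    exact E.zero_mem
  rw [Polynomial.coeff_eq_esymm_roots_of_splits (IsAlgClosed.splits _) (hi.trans_eq hdeg.symm),
    T.charpoly_monic.leadingCoeff, one_mul, hdeg]
  refine E.mul_mem (pow_mem (neg_mem E.one_mem) _)
    (Multiset.esymm_mem_of_sum_pow_mem E _ n (fun m hm hmn => ?_) _ (n.sub_le i))
  let b := Module.finBasis ℂ V
  rw [← T.charpoly_toMatrix b, ← Matrix.trace_pow_eq_sum_roots_charpoly, LinearMap.toMatrix_pow,
    ← LinearMap.trace_eq_matrix_trace]
  exact htr m hm hmn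
end

section
/- Let V be a finite-dimensional complex vector space of dimension n, let E ⊆ ℂ be a number field, and let 𝒯 be a family of pairwise commuting, diagonalizable linear endomorphisms of V, closed under finite ℚ-linear combinations, such that the characteristic polynomial of every T ∈ 𝒯 has all its coefficients in E. For T ∈ 𝒯 let E_T ⊆ ℂ denote the splitting field over E of the characteristic polynomial of T (the subfield of ℂ generated by E and the eigenvalues of T). Then there exists T₀ ∈ 𝒯 such that E_T ⊆ E_{T₀} for every T ∈ 𝒯; in particular the field degree [E_T : E] is maximized at T₀ and every eigenvalue of every element of 𝒯 lies in the number field E_{T₀}. -/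
open Module IntermediateField in
/-- Adjoining the finite set `s` of elements of degree at most `n` gives an extension of degree
at most `n ^ #s`. -/
theorem finrank_adjoin_finset_le {K L : Type*} [Field K] [Field L] [Algebra K L] (n : ℕ)
    (s : Finset L) (hs : ∀ x ∈ s, IsIntegral K x ∧ (minpoly K x).natDegree ≤ n) :
    finrank K (adjoin K (s : Set L)) ≤ n ^ s.card := by
  classical
  induction s using Finset.induction_on with
  | empty => rw [Finset.coe_empty, adjoin_empty, IntermediateField.finrank_bot,
      Finset.card_empty, pow_zero]
  | insert a s ha ih =>
    have hmem := hs a (Finset.mem_insert_self a s)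
    rw [Finset.coe_insert, Set.insert_eq, adjoin_union, Finset.card_insert_of_notMem ha, pow_succ']
    refine (finrank_sup_le _ _).trans (Nat.mul_le_mul ?_ ?_)
    · exact (adjoin.finrank hmem.1).trans_le hmem.2
    · exact ih fun x hx ↦ hs x (Finset.mem_insert_of_mem hx)

open Module in
/-- Every eigenvalue of `T` has an eigenvector that is also an eigenvector of a given
endomorphism commuting with `T`. -/
theorem exists_common_eigenvector {K V : Type*} [Field K] [IsAlgClosed K] [AddCommGroup V]
    [Module K V] [FiniteDimensional K V] {S T : End K V} (h : Commute T S) {a : K}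
    (ha : T.HasEigenvalue a) : ∃ b : K, ∃ v : V, v ≠ 0 ∧ T v = a • v ∧ S v = b • v := by
  have hmaps : Set.MapsTo S (T.eigenspace a) (T.eigenspace a) :=
    End.mapsTo_genEigenspace_of_comm h a 1
  have : Nontrivial (T.eigenspace a) := Submodule.nontrivial_iff_ne_bot.2 ha
  obtain ⟨b, hb⟩ := End.exists_eigenvalue (S.restrict hmaps)
  obtain ⟨v, hv⟩ := hb.exists_hasEigenvector
  refine ⟨b, v, ?_, End.mem_eigenspace_iff.1 v.2, ?_⟩
  · simpa using hv.2
  · exact congrArg Subtype.val hv.apply_eq_smul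

/-- In characteristic zero, an infinite family of intermediate fields contained in a finite
extension of the base field takes some value twice. -/
theorem exists_ne_eq_of_forall_le {K L ι : Type*} [Field K] [CharZero K] [Field L] [Algebra K L]
    [Infinite ι] (M : IntermediateField K L) [FiniteDimensional K M]
    (F : ι → IntermediateField K L) (hF : ∀ i, F i ≤ M) : ∃ i j, i ≠ j ∧ F i = F j := by
  have : Finite (IntermediateField K M) :=
    Field.finite_intermediateField_of_exists_primitive_element K M
      (Field.exists_primitive_element K M)
  obtain ⟨i, j, hij, h⟩ := Finite.exists_ne_map_eq_of_infinite
    fun i ↦ IntermediateField.restrict (hF i)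
  refine ⟨i, j, hij, ?_⟩
  simpa only [IntermediateField.lift_restrict] using congrArg IntermediateField.lift h

open Module in
/-- The extension of `K` generated by the eigenvalues of `T`. -/
abbrev eigenvalueField (K : Type*) {L V : Type*} [Field K] [Field L] [Algebra K L]
    [AddCommGroup V] [Module L V] (T : End L V) : IntermediateField K L :=
  IntermediateField.adjoin K {a : L | T.HasEigenvalue a}

section eigenvalueField

variable {K L V : Type*} [Field K] [Field L] [Algebra K L] [AddCommGroup V] [Module L V]

open Module

theorem mem_eigenvalueField {T : End L V} {a : L} {v : V} (hv : v ≠ 0) (h : T v = a • v) :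
    a ∈ eigenvalueField K T :=
  IntermediateField.subset_adjoin K _
    (End.hasEigenvalue_of_hasEigenvector ⟨End.mem_eigenspace_iff.2 h, hv⟩)

variable [FiniteDimensional L V]

theorem isIntegral_and_natDegree_minpoly_le {T : End L V}
    (hT : T.charpoly ∈ Polynomial.lifts (algebraMap K L)) {a : L} (ha : T.HasEigenvalue a) :
    IsIntegral K a ∧ (minpoly K a).natDegree ≤ finrank L V := by
  obtain ⟨q, hq, hdeg, hmonic⟩ :=
    Polynomial.lifts_and_natDegree_eq_and_monic hT T.charpoly_monic
  have hroot : Polynomial.aeval a q = 0 := by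
    rw [Polynomial.aeval_def, ← Polynomial.eval_map, hq]
    exact (End.hasEigenvalue_iff_isRoot_charpoly T a).1 ha
  refine ⟨⟨q, hmonic, hroot⟩, ?_⟩
  rw [← T.charpoly_natDegree, ← hdeg]
  exact Polynomial.natDegree_le_of_dvd (minpoly.dvd K a hroot) hmonic.ne_zero

theorem finiteDimensional_eigenvalueField {T : End L V}
    (hT : T.charpoly ∈ Polynomial.lifts (algebraMap K L)) :
    FiniteDimensional K (eigenvalueField K T) :=
  have : Finite {a : L | T.HasEigenvalue a} := T.finite_hasEigenvalue
  IntermediateField.finiteDimensional_adjoin fun _ ha ↦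
    (isIntegral_and_natDegree_minpoly_le hT ha).1

theorem finrank_eigenvalueField_le {T : End L V}
    (hT : T.charpoly ∈ Polynomial.lifts (algebraMap K L)) :
    finrank K (eigenvalueField K T) ≤ finrank L V ^ finrank L V := by
  classical
  have hset : {a : L | T.HasEigenvalue a} = (T.charpoly.roots.toFinset : Set L) := by
    ext a
    simp [End.hasEigenvalue_iff_isRoot_charpoly, T.charpoly_monic.ne_zero]
  have hcard : T.charpoly.roots.toFinset.card ≤ finrank L V :=
    (Multiset.toFinset_card_le _).trans
      ((Polynomial.card_roots' _).trans_eq T.charpoly_natDegree)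
  rw [eigenvalueField, hset]
  refine (finrank_adjoin_finset_le (finrank L V) _ fun a ha ↦ ?_).trans ?_
  · exact isIntegral_and_natDegree_minpoly_le hT (hset.symm.subset ha)
  · rcases Nat.eq_zero_or_pos (finrank L V) with h0 | hpos
    · simp_all
    · exact Nat.pow_le_pow_right hpos hcard

theorem eigenvalueField_le_of_commute [IsAlgClosed L] {S T : End L V} (h : Commute T S)
    (F : IntermediateField K L)
    (hF : ∀ a b : L, ∀ v : V, v ≠ 0 → T v = a • v → S v = b • v → a ∈ F) :
    eigenvalueField K T ≤ F := by
  refine IntermediateField.adjoin_le_iff.2 fun a ha ↦ ?_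
  obtain ⟨b, v, hv, hTv, hSv⟩ := exists_common_eigenvector h ha
  exact hF a b v hv hTv hSv

/-- For commuting `S` and `T` whose characteristic polynomials are defined over `K`, some
rational combination `T + r S` has all eigenvalues of `S` and of `T` in its eigenvalue field. -/
theorem exists_eigenvalueField_le_add_smul [CharZero K] [CharZero L] [IsAlgClosed L]
    {S T : End L V} (h : Commute T S) (hS : S.charpoly ∈ Polynomial.lifts (algebraMap K L))
    (hT : T.charpoly ∈ Polynomial.lifts (algebraMap K L)) :
    ∃ r : ℚ, eigenvalueField K T ≤ eigenvalueField K (T + (r : L) • S) ∧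
      eigenvalueField K S ≤ eigenvalueField K (T + (r : L) • S) := by
  have := finiteDimensional_eigenvalueField hS
  have := finiteDimensional_eigenvalueField hT
  have hrat (F : IntermediateField K L) (r : ℚ) : (r : L) ∈ F := by
    simp
  obtain ⟨r, s, hrs, heq⟩ := exists_ne_eq_of_forall_le
    (eigenvalueField K T ⊔ eigenvalueField K S)
    (fun r : ℚ ↦ eigenvalueField K (T + (r : L) • S)) fun r ↦ by
      refine IntermediateField.adjoin_le_iff.2 fun c hc ↦ ?_
      obtain ⟨b, v, hv, hTSv, hSv⟩ :=
        exists_common_eigenvector (h.add_left ((Commute.refl S).smul_left (r : L))) hc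
      have hTv : T v = (c - r * b) • v := by
        rw [sub_smul, ← hTSv, mul_smul, ← hSv]
        simp
      have ha := (le_sup_left : _ ≤ eigenvalueField K T ⊔ eigenvalueField K S)
        (mem_eigenvalueField (K := K) hv hTv)
      have hb := (le_sup_right : _ ≤ eigenvalueField K T ⊔ eigenvalueField K S)
        (mem_eigenvalueField (K := K) hv hSv)
      simpa using add_mem ha (mul_mem (hrat _ r) hb)
  have key (a b : L) (v : V) (hv : v ≠ 0) (hTv : T v = a • v) (hSv : S v = b • v) :
      a ∈ eigenvalueField K (T + (r : L) • S) ∧ b ∈ eigenvalueField K (T + (r : L) • S) := by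
    have hcomb (q : ℚ) : a + q * b ∈ eigenvalueField K (T + (q : L) • S) :=
      mem_eigenvalueField hv (by simp [hTv, hSv, add_smul, mul_smul])
    have h1 := hcomb r
    have h2 : a + s * b ∈ eigenvalueField K (T + (r : L) • S) := heq ▸ hcomb s
    have hne : (r : L) - s ≠ 0 := sub_ne_zero.2 (by exact_mod_cast hrs)
    have hb : b ∈ eigenvalueField K (T + (r : L) • S) := by
      have hdiv := div_mem (sub_mem h1 h2) (sub_mem (hrat _ r) (hrat _ s))
      rwa [show (a + r * b - (a + s * b)) / ((r : L) - s) = b by field_simp; ring] at hdiv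
    exact ⟨by simpa using sub_mem h1 (mul_mem (hrat _ r) hb), hb⟩
  exact ⟨r, eigenvalueField_le_of_commute h _ fun a b v hv hTv hSv ↦ (key a b v hv hTv hSv).1,
    eigenvalueField_le_of_commute h.symm _ fun b a v hv hSv hTv ↦ (key a b v hv hTv hSv).2⟩

end eigenvalueField

/-- **Refined form of the proof of Proposition 3.2.**
Let `V` be an `n`-dimensional complex vector space, `E ⊆ ℂ` a number field, and `𝒯` a
family of pairwise commuting diagonalizable endomorphisms of `V`, closed under finite
`ℚ`-linear combinations, whose characteristic polynomials all have coefficients in `E`.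
Writing `E_T` for the subfield of `ℂ` generated by `E` and the eigenvalues of `T` (the
splitting field over `E` of the characteristic polynomial of `T`), there exists `T₀ ∈ 𝒯`
with `E_T ⊆ E_{T₀}` for all `T ∈ 𝒯`; in particular every eigenvalue of every element of
`𝒯` lies in `E_{T₀}`. -/
theorem stmt6 (V : Type*) [AddCommGroup V] [Module ℂ V] [FiniteDimensional ℂ V]
    (n : ℕ) (hdim : Module.finrank ℂ V = n)
    (E : Subfield ℂ) (hE : FiniteDimensional ℚ E)
    (𝒯 : Set (Module.End ℂ V))
    (hzero : (0 : Module.End ℂ V) ∈ 𝒯)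
    (hclosed : ∀ (q r : ℚ), ∀ S ∈ 𝒯, ∀ T ∈ 𝒯, (q : ℂ) • S + (r : ℂ) • T ∈ 𝒯)
    (hcomm : ∀ S ∈ 𝒯, ∀ T ∈ 𝒯, S * T = T * S)
    (hdiag : ∀ T ∈ 𝒯, (⨆ μ : ℂ, Module.End.eigenspace T μ) = ⊤)
    (hcoeff : ∀ T ∈ 𝒯, ∀ i : ℕ, (LinearMap.charpoly T).coeff i ∈ E) :
    ∃ T₀ ∈ 𝒯,
      (∀ T ∈ 𝒯,
        IntermediateField.adjoin ↥E {μ : ℂ | Module.End.HasEigenvalue T μ} ≤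
          IntermediateField.adjoin ↥E {μ : ℂ | Module.End.HasEigenvalue T₀ μ}) ∧
      ∀ T ∈ 𝒯, ∀ μ : ℂ, Module.End.HasEigenvalue T μ →
        μ ∈ IntermediateField.adjoin ↥E {μ : ℂ | Module.End.HasEigenvalue T₀ μ} := by
  have hlifts : ∀ T ∈ 𝒯, T.charpoly ∈ Polynomial.lifts (algebraMap E ℂ) := fun T hT ↦
    (Polynomial.lifts_iff_coeff_lifts _).2 fun i ↦ ⟨⟨_, hcoeff T hT i⟩, rfl⟩
  let degrees : Set ℕ := (fun T ↦ Module.finrank E (eigenvalueField E T)) '' 𝒯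
  have hbdd : BddAbove degrees := by
    refine ⟨Module.finrank ℂ V ^ Module.finrank ℂ V, ?_⟩
    rintro _ ⟨T, hT, rfl⟩
    exact finrank_eigenvalueField_le (hlifts T hT)
  obtain ⟨T₀, hT₀, hmax⟩ : sSup degrees ∈ degrees :=
    Nat.sSup_mem ⟨_, Set.mem_image_of_mem _ hzero⟩ hbdd
  have hle : ∀ T ∈ 𝒯, eigenvalueField E T ≤ eigenvalueField E T₀ := by
    intro T hT
    obtain ⟨r, h₀, h₁⟩ := exists_eigenvalueField_le_add_smul (hcomm T₀ hT₀ T hT)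
      (hlifts T hT) (hlifts T₀ hT₀)
    have hmem : T₀ + (r : ℂ) • T ∈ 𝒯 := by simpa using hclosed 1 r T₀ hT₀ T hT
    have := finiteDimensional_eigenvalueField (hlifts _ hmem)
    have hfin : Module.finrank E (eigenvalueField E (T₀ + (r : ℂ) • T)) ≤
        Module.finrank E (eigenvalueField E T₀) :=
      (le_csSup hbdd (Set.mem_image_of_mem _ hmem)).trans_eq hmax.symm
    rwa [IntermediateField.eq_of_le_of_finrank_le h₀ hfin]
  exact ⟨T₀, hT₀, hle, fun T hT μ hμ ↦ hle T hT (IntermediateField.subset_adjoin E _ hμ)⟩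
end
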